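/- Let W be a Coxeter group of affine type D̃_{n+2} and let w ∈ FC(W) be star reducible to star irreducible elements v and v′. If neither v nor v′ is a product of pairwise commuting generators, then v = v′. -/

import Mathlib

open CoxeterSystem

namespace CoxFC


open CoxeterSystem


variable {B : Type*} {W : Type*} [Group W] {M : CoxeterMatrix B}

/-- One commutation move: swap two adjacent commuting letters. -/
def CommStep (M : CoxeterMatrix B) (l l' : List B) : Prop :=
  ∃ (l₁ l₂ : List B) (a b : B), M a b = 2 ∧
    l = l₁ ++ a :: b :: l₂ ∧ l' = l₁ ++ b :: a :: l₂

/-- Two words are commutation equivalent if related by a sequence of commutation moves. -/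
def CommEquiv (M : CoxeterMatrix B) : List B → List B → Prop :=
  Relation.ReflTransGen (CommStep M)

/-- A fully commutative element: any two reduced expressions are commutation equivalent. -/
def IsFC (cs : CoxeterSystem M W) (w : W) : Prop :=
  ∀ l l' : List B, cs.IsReduced l → cs.IsReduced l' →
    cs.wordProd l = w → cs.wordProd l' = w → CommEquiv M l l'

/-- `m s t ≥ 3`, where a matrix entry `0` denotes `∞`. -/
def Big (M : CoxeterMatrix B) (s t : B) : Prop := 3 ≤ M s t ∨ M s t = 0

/-- `w` is left star reducible by `s` with respect to `t`. -/
def IsLeftStarReducible (cs : CoxeterSystem M W) (s t : B) (w : W) : Prop :=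
  Big M s t ∧ cs.IsLeftDescent w s ∧ cs.IsLeftDescent (cs.simple s * w) t

/-- `w` is right star reducible by `s` with respect to `t`. -/
def IsRightStarReducible (cs : CoxeterSystem M W) (s t : B) (w : W) : Prop :=
  Big M s t ∧ cs.IsRightDescent w s ∧ cs.IsRightDescent (w * cs.simple s) t

/-- A single left star reduction step from `w` to `v`. -/
def LeftStarStep (cs : CoxeterSystem M W) (w v : W) : Prop :=
  ∃ s t : B, IsLeftStarReducible cs s t w ∧ v = cs.simple s * w

/-- A single (left or right) star reduction step from `w` to `v`. -/
def StarStep (cs : CoxeterSystem M W) (w v : W) : Prop :=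
  ∃ s t : B, (IsLeftStarReducible cs s t w ∧ v = cs.simple s * w) ∨
    (IsRightStarReducible cs s t w ∧ v = w * cs.simple s)

/-- `w` admits no left star reduction. -/
def LeftStarIrreducible (cs : CoxeterSystem M W) (w : W) : Prop :=
  ∀ s t : B, ¬ IsLeftStarReducible cs s t w

/-- `w` admits no star reduction at all. -/
def StarIrreducible (cs : CoxeterSystem M W) (w : W) : Prop :=
  ∀ s t : B, ¬ IsLeftStarReducible cs s t w ∧ ¬ IsRightStarReducible cs s t w

/-- A product of pairwise commuting generators (including the identity). -/
def IsCC (cs : CoxeterSystem M W) (w : W) : Prop :=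
  ∃ l : List B, cs.IsReduced l ∧ cs.wordProd l = w ∧
    ∀ a ∈ l, ∀ b ∈ l, a ≠ b → M a b = 2

/-- The support of `w`: generators appearing in some reduced expression. -/
def Supp (cs : CoxeterSystem M W) (w : W) : Set B :=
  {a | ∃ l : List B, cs.IsReduced l ∧ cs.wordProd l = w ∧ a ∈ l}

/-- `us` is the Cartier–Foata normal form of `w`, presented as a list of words,
each a product of pairwise commuting generators. -/
def IsCFNF (cs : CoxeterSystem M W) (w : W) (us : List (List B)) : Prop :=
  (∀ l ∈ us, l ≠ []) ∧
  cs.wordProd us.flatten = w ∧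
  cs.IsReduced us.flatten ∧
  (∀ l ∈ us, ∀ a ∈ l, ∀ b ∈ l, a ≠ b → M a b = 2) ∧
  (∀ a : B, (∃ l ∈ us.head?, a ∈ l) ↔ cs.IsLeftDescent w a) ∧
  (∀ j : ℕ, j + 1 < us.length → ∀ t ∈ us.getD (j+1) [],
      ∃ s ∈ us.getD j [], Big M s t)



/-- One orientation of the edges of the Coxeter graph of type D̃_{n+2}. -/
def DHalf (n a b : ℕ) : Prop :=
  (a = 0 ∧ b = 2) ∨ (a = 1 ∧ b = 2) ∨ (2 ≤ a ∧ a ≤ n ∧ b = a + 1) ∨ (a = n ∧ b = n + 2)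

/-- Adjacency (bond of order 3) in the Coxeter graph of type D̃_{n+2}:
`s_0, s_1` are joined to `s_2`, `s_2 — s_3 — ⋯ — s_n` is a path, and
`s_{n+1}, s_{n+2}` are joined to `s_n`. -/
def DAdj (n a b : ℕ) : Prop := DHalf n a b ∨ DHalf n b a

instance (n a b : ℕ) : Decidable (DAdj n a b) := by unfold DAdj DHalf; infer_instance

lemma dAdj_symm (n a b : ℕ) : DAdj n a b ↔ DAdj n b a := or_comm

lemma dHalf_ne (n a b : ℕ) (h : DHalf n a b) : a ≠ b := by unfold DHalf at h; omega

lemma dAdj_ne (n a b : ℕ) (h : DAdj n a b) : a ≠ b := by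
  rcases h with h | h
  · exact dHalf_ne n a b h
  · exact (dHalf_ne n b a h).symm

/-- The Coxeter matrix of affine type D̃_{n+2}, with vertices `s_0, …, s_{n+2}`. -/
def DMatrix (n : ℕ) : CoxeterMatrix (Fin (n+3)) where
  M := Matrix.of fun i j : Fin (n+3) ↦
    if DAdj n i j then 3 else if i = j then 1 else 2
  isSymm := by
    apply Matrix.IsSymm.ext
    intro i j
    simp only [Matrix.of_apply]
    by_cases h : DAdj n (i : ℕ) (j : ℕ)
    · rw [if_pos h, if_pos ((dAdj_symm n (i : ℕ) (j : ℕ)).mp h)]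
    · rw [if_neg h, if_neg (fun hh => h ((dAdj_symm n (j : ℕ) (i : ℕ)).mp hh))]
      by_cases h2 : (j : Fin (n+3)) = i
      · simp [h2]
      · rw [if_neg h2, if_neg (fun hh => h2 hh.symm)]
  diagonal i := by
    have : ¬ DAdj n (i : ℕ) (i : ℕ) := fun h => dAdj_ne n i i h rfl
    simp [this]
  off_diagonal i j h := by
    have h2 : (i : Fin (n+3)) ≠ j := h
    by_cases hA : DAdj n (i : ℕ) (j : ℕ) <;> simp [Matrix.of_apply, hA, h2]

/-- The generator `s_k` of type D̃_{n+2}, for `k ≤ n+2`. -/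
def dv (n k : ℕ) : Fin (n+3) := ⟨k % (n+3), Nat.mod_lt _ (Nat.succ_pos _)⟩



/-! ### Words, projections and left descents -/

section Words

set_option linter.unusedSectionVars false

variable [DecidableEq B]

/-- All reduced words of `w` have the same projections to pairs of non-commuting letters. -/
def PFC (cs : CoxeterSystem M W) (w : W) : Prop :=
  ∀ l l' : List B, cs.IsReduced l → cs.IsReduced l' → cs.wordProd l = w → cs.wordProd l' = w →
    ∀ a b, M a b ≠ 2 →
      l.filter (fun c => c = a ∨ c = b) = l'.filter (fun c => c = a ∨ c = b)


lemma commStep_filter {l l' : List B} (h : CommStep M l l') (a b : B) (hab : M a b ≠ 2) :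
    l.filter (fun c => c = a ∨ c = b) = l'.filter (fun c => c = a ∨ c = b) := by
  obtain ⟨l₁, l₂, p, q, hpq, rfl, rfl⟩ := h
  have hpp : p ≠ q := by
    rintro rfl
    simp at hpq
  have hba : M b a ≠ 2 := by rwa [M.symmetric]
  simp only [List.filter_append, List.filter_cons]
  congr 1
  by_cases h1 : p = a ∨ p = b <;> by_cases h2 : q = a ∨ q = b <;> simp [h1, h2]
  rcases h1 with rfl | rfl <;> rcases h2 with rfl | rfl <;> simp_all

lemma commEquiv_filter {l l' : List B} (h : CommEquiv M l l') (a b : B) (hab : M a b ≠ 2) :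
    l.filter (fun c => c = a ∨ c = b) = l'.filter (fun c => c = a ∨ c = b) := by
  induction h with
  | refl => rfl
  | tail _ h2 ih => exact ih.trans (commStep_filter h2 a b hab)

lemma IsFC.pfc {cs : CoxeterSystem M W} {w : W} (h : IsFC cs w) : PFC cs w :=
  fun l l' hl hl' e e' a b hab => commEquiv_filter (h l l' hl hl' e e') a b hab

lemma PFC.inv {cs : CoxeterSystem M W} {w : W} (h : PFC cs w) : PFC cs w⁻¹ := by
  intro l l' hl hl' e e' a b hab
  have := h l.reverse l'.reverse hl.reverse hl'.reverse (by simp [e]) (by simp [e']) a b hab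
  simpa [List.filter_reverse] using this

/-- Reducedness is length additivity. -/
lemma reduced_append {cs : CoxeterSystem M W} {x y : W} {lx ly : List B}
    (hx : cs.IsReduced lx) (hy : cs.IsReduced ly) (ex : cs.wordProd lx = x)
    (ey : cs.wordProd ly = y) (h : cs.length (x * y) = cs.length x + cs.length y) :
    cs.IsReduced (lx ++ ly) := by
  unfold CoxeterSystem.IsReduced at *
  rw [wordProd_append, ex, ey, h, List.length_append, ← hx, ← hy, ex, ey]

lemma left_of_append {cs : CoxeterSystem M W} {lx ly : List B} (h : cs.IsReduced (lx ++ ly)) :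
    cs.IsReduced lx := by
  simpa using h.take lx.length

lemma right_of_append {cs : CoxeterSystem M W} {lx ly : List B} (h : cs.IsReduced (lx ++ ly)) :
    cs.IsReduced ly := by
  simpa using h.drop lx.length

/-- `w = x v y` with lengths adding up. -/
def Cont (cs : CoxeterSystem M W) (w v : W) : Prop :=
  ∃ x y : List B, ∀ l, cs.IsReduced l → cs.wordProd l = v →
    cs.IsReduced (x ++ l ++ y) ∧ cs.wordProd (x ++ l ++ y) = w

lemma Cont.of {cs : CoxeterSystem M W} {x l y : List B} (h : cs.IsReduced (x ++ l ++ y)) :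
    Cont cs (cs.wordProd (x ++ l ++ y)) (cs.wordProd l) := by
  refine ⟨x, y, fun l' hl' e => ?_⟩
  have hl : cs.IsReduced l := right_of_append (left_of_append h)
  have e1 : cs.wordProd (x ++ l' ++ y) = cs.wordProd (x ++ l ++ y) := by
    simp [wordProd_append, e]
  refine ⟨?_, e1⟩
  unfold CoxeterSystem.IsReduced at *
  rw [e1, h]
  have : l'.length = l.length := by rw [← hl', ← hl, e]
  simp [this]

lemma Cont.refl (cs : CoxeterSystem M W) (w : W) : Cont cs w w :=
  ⟨[], [], fun l h e => by simpa using ⟨h, e⟩⟩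

lemma Cont.trans {cs : CoxeterSystem M W} {u v w : W} (h1 : Cont cs u v) (h2 : Cont cs v w) :
    Cont cs u w := by
  obtain ⟨x, y, h1⟩ := h1
  obtain ⟨x', y', h2⟩ := h2
  refine ⟨x ++ x', y' ++ y, fun l hl e => ?_⟩
  have h3 := h2 l hl e
  simpa using h1 _ h3.1 h3.2

lemma Cont.inv {cs : CoxeterSystem M W} {u v : W} (h1 : Cont cs u v) : Cont cs u⁻¹ v⁻¹ := by
  obtain ⟨x, y, h1⟩ := h1
  refine ⟨y.reverse, x.reverse, fun l hl e => ?_⟩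
  have h3 := h1 l.reverse hl.reverse (by simp [e])
  have e4 : y.reverse ++ l ++ x.reverse = (x ++ l.reverse ++ y).reverse := by simp
  rw [e4]
  exact ⟨h3.1.reverse, by rw [wordProd_reverse, h3.2]⟩

lemma Cont.length {cs : CoxeterSystem M W} {u v : W} (h1 : Cont cs u v) :
    cs.length v ≤ cs.length u ∧ (cs.length v = cs.length u → v = u) := by
  obtain ⟨x, y, h1⟩ := h1
  obtain ⟨l, hl, rfl⟩ := cs.exists_isReduced v
  obtain ⟨h2, rfl⟩ := h1 l hl rfl
  rw [hl.eq, h2.eq]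
  constructor
  · simp; omega
  · intro h
    have hx : x = [] := by
      apply List.eq_nil_of_length_eq_zero; simp at h; omega
    have hy : y = [] := by
      apply List.eq_nil_of_length_eq_zero; simp at h; omega
    simp [hx, hy]

lemma PFC.cont {cs : CoxeterSystem M W} {u v : W} (hu : PFC cs u) (h1 : Cont cs u v) :
    PFC cs v := by
  obtain ⟨x, y, h1⟩ := h1
  intro l l' hl hl' e e' a b hab
  have h2 := h1 l hl e
  have h3 := h1 l' hl' e'
  have := hu _ _ h2.1 h3.1 h2.2 h3.2 a b hab
  simp only [List.filter_append] at this
  exact List.append_cancel_left (List.append_cancel_right this)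

lemma reduced_cons_of_descent {cs : CoxeterSystem M W} {w : W} {s : B}
    (h : cs.IsLeftDescent w s) {l : List B} (hl : cs.IsReduced l)
    (e : cs.wordProd l = cs.simple s * w) :
    cs.IsReduced (s :: l) ∧ cs.wordProd (s :: l) = w := by
  have e2 : cs.wordProd (s :: l) = w := by simp [wordProd_cons, e]
  refine ⟨?_, e2⟩
  unfold CoxeterSystem.IsReduced at *
  rw [e2]
  have := (cs.isLeftDescent_iff).1 h
  rw [← e, hl] at this
  simp [this]

lemma descent_of_cons {cs : CoxeterSystem M W} {s : B} {l : List B}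
    (hl : cs.IsReduced (s :: l)) : cs.IsLeftDescent (cs.wordProd (s :: l)) s := by
  have h2 : cs.IsReduced l := by simpa using hl.drop 1
  unfold CoxeterSystem.IsLeftDescent
  rw [hl.eq, wordProd_cons, simple_mul_simple_cancel_left, h2.eq]
  simp

/-- In a fully commutative element a left descent can be pulled to the front of any
reduced word by commutations. -/
lemma PFC.front {cs : CoxeterSystem M W} {w : W} (hw : PFC cs w) {l : List B}
    (hl : cs.IsReduced l) (e : cs.wordProd l = w) {s : B} (hs : cs.IsLeftDescent w s) :
    ∃ p q, l = p ++ s :: q ∧ ∀ c ∈ p, M s c = 2 := by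
  obtain ⟨l', hl', e'⟩ := cs.exists_isReduced (cs.simple s * w)
  obtain ⟨h1, h2⟩ := reduced_cons_of_descent hs hl' e'.symm
  have key := hw l (s :: l') hl h1 e h2
  have hmem : s ∈ l := by
    have := key s s (by simp)
    have h3 : s ∈ List.filter (fun c => decide (c = s ∨ c = s)) (s :: l') := by simp
    rw [← this] at h3
    exact (List.mem_filter.1 h3).1
  obtain ⟨p, q, rfl, hp⟩ := List.eq_append_cons_of_mem hmem
  refine ⟨p, q, rfl, fun c hc => ?_⟩
  by_contra hne
  have := key s c hne
  have hc' : c ∈ p.filter (fun d => decide (d = s ∨ d = c)) := by simp [hc]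
  rcases hf : p.filter (fun d => decide (d = s ∨ d = c)) with _ | ⟨d, r⟩
  · rw [hf] at hc'
    simp at hc'
  · rw [List.filter_append, hf] at this
    simp at this
    have hd : d ∈ p := by
      have : d ∈ p.filter (fun d => decide (d = s ∨ d = c)) := by rw [hf]; simp
      exact (List.mem_filter.1 this).1
    exact hp (this.1 ▸ hd)

lemma simple_comm (cs : CoxeterSystem M W) {s c : B} (h : M s c = 2) :
    cs.simple c * cs.simple s = cs.simple s * cs.simple c := by
  have := cs.simple_mul_simple_pow s c
  rw [h, pow_two] at this
  have h2 := mul_eq_one_iff_eq_inv.1 this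
  simp only [mul_inv_rev, inv_simple] at h2
  exact h2.symm

lemma first_unique {t : B} : ∀ {p p' r r' : List B}, t ∉ p → t ∉ p' →
    p ++ t :: r = p' ++ t :: r' → p = p' ∧ r = r'
  | [], [], _, _, _, _, h => by simpa using h
  | [], b :: p', _, _, _, h2, h => by
    simp at h h2
    exact absurd h.1 h2.1
  | a :: p, [], _, _, h1, _, h => by
    simp at h h1
    exact absurd h.1.symm h1.1
  | a :: p, b :: p', _, _, h1, h2, h => by
    simp at h h1 h2
    have := first_unique h1.2 h2.2 h.2
    simp [h.1, this]

lemma pull (cs : CoxeterSystem M W) {s : B} {p : List B} (q : List B)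
    (h : ∀ c ∈ p, M s c = 2) : cs.wordProd (p ++ s :: q) = cs.wordProd (s :: (p ++ q)) := by
  induction p with
  | nil => rfl
  | cons c p ih =>
    have h1 := ih fun d hd => h d (by simp [hd])
    have h2 := simple_comm cs (h c (by simp))
    simp only [List.cons_append, wordProd_cons] at *
    rw [h1, ← mul_assoc, h2, mul_assoc]

lemma reduced_congr {cs : CoxeterSystem M W} {l l' : List B} (hl : cs.IsReduced l)
    (e : cs.wordProd l = cs.wordProd l') (hlen : l'.length = l.length) : cs.IsReduced l' := by
  unfold CoxeterSystem.IsReduced at *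
  rw [← e, hl, hlen]

lemma pull_reduced {cs : CoxeterSystem M W} {s : B} {p q : List B}
    (h : ∀ c ∈ p, M s c = 2) (hr : cs.IsReduced (p ++ s :: q)) :
    cs.IsReduced (s :: (p ++ q)) :=
  reduced_congr hr (pull cs q h) (by simp; omega)

/-- If `s`, then `t`, can be pulled to the front, the element is left star reducible. -/
lemma star_of_pull {cs : CoxeterSystem M W} {s t : B} {p q r : List B} {l : List B}
    (hst : Big M s t) (hl : cs.IsReduced l) (e : l = p ++ s :: q)
    (hp : ∀ c ∈ p, M s c = 2) {p' : List B} (e2 : p ++ q = p' ++ t :: r)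
    (hp' : ∀ c ∈ p', M t c = 2) : IsLeftStarReducible cs s t (cs.wordProd l) := by
  subst e
  have h1 := pull_reduced hp hl
  have h2 : cs.IsReduced (p ++ q) := by simpa using h1.drop 1
  have e3 := pull cs q hp
  refine ⟨hst, ?_, ?_⟩
  · rw [e3]; exact descent_of_cons h1
  · rw [e3, wordProd_cons, simple_mul_simple_cancel_left]
    rw [e2] at h2 ⊢
    rw [pull cs r hp']
    exact descent_of_cons (pull_reduced hp' h2)

lemma big_ne_two {s t : B} (h : Big M s t) : M s t ≠ 2 := by
  unfold Big at h; omega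

/-- A left star reduction of `w` keeps any full-support irreducible factor of `w`. -/
lemma keep_left {cs : CoxeterSystem M W} {w v : W} (hw : PFC cs w) (hc : Cont cs w v)
    (hfull : ∀ l, cs.IsReduced l → cs.wordProd l = v → ∀ a, a ∈ l)
    (hirr : LeftStarIrreducible cs v) {s t : B} (hst : IsLeftStarReducible cs s t w) :
    Cont cs (cs.simple s * w) v := by
  obtain ⟨x, y, hxy⟩ := hc
  obtain ⟨l, hl, rfl⟩ := cs.exists_isReduced v
  obtain ⟨hr, e⟩ := hxy l hl rfl
  obtain ⟨hbig, hs, ht⟩ := hst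
  have hcc : Cont cs w (cs.simple s * w) := by
    obtain ⟨m, hm, em⟩ := cs.exists_isReduced (cs.simple s * w)
    have h1 := reduced_cons_of_descent hs hm em.symm
    have h2 : cs.IsReduced ([s] ++ m ++ []) := by simpa using h1.1
    have := Cont.of h2
    rw [← em] at this
    simpa [h1.2] using this
  have hsw : PFC cs (cs.simple s * w) := hw.cont hcc
  have hsl := hfull l hl rfl s
  have htl := hfull l hl rfl t
  obtain ⟨p, q, e1, hp⟩ := hw.front hr e hs
  have hpr := pull_reduced hp (e1 ▸ hr)
  have hpq : cs.IsReduced (p ++ q) := by simpa using hpr.drop 1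
  have epq : cs.wordProd (p ++ q) = cs.simple s * w := by
    rw [← e, e1, pull cs q hp, wordProd_cons, simple_mul_simple_cancel_left]
  have hsp : s ∉ p := fun h => by simpa using hp s h
  rw [List.append_assoc] at e1
  have e1' : (∃ a, p = x ++ a ∧ l ++ y = a ++ s :: q) ∨
      (∃ a, x = p ++ s :: a ∧ q = a ++ (l ++ y)) := by
    rcases List.append_eq_append_iff.1 e1 with ⟨a, h1, h2⟩ | ⟨a, h1, h2⟩
    · exact Or.inl ⟨a, h1, h2⟩
    · rcases a with _ | ⟨a0, a⟩
      · refine Or.inl ⟨[], by simpa using h1.symm, by simpa using h2.symm⟩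
      · simp only [List.cons_append, List.cons.injEq] at h2
        obtain ⟨rfl, h2⟩ := h2
        exact Or.inr ⟨a, h1, h2⟩
  rcases e1' with ⟨a, rfl, h2⟩ | ⟨a, rfl, rfl⟩
  · -- `p = x ++ a`
    rcases List.append_eq_append_iff.1 h2 with ⟨b, rfl, h3⟩ | ⟨b, rfl, h3⟩
    · exact absurd (List.mem_append_right x (List.mem_append_left b hsl)) hsp
    · rcases b with _ | ⟨b0, b⟩
      · exfalso
        simp at hsl hsp
        exact hsp.2 hsl
      · simp only [List.cons_append, List.cons.injEq] at h3
        obtain ⟨rfl, rfl⟩ := h3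
        exfalso
        obtain ⟨p', r, e3, hp'⟩ := hsw.front hpq epq ht
        -- the first `t` of `x ++ a ++ b ++ y` lies in `b`
        have htxa : t ∉ x ++ a := fun h => big_ne_two hbig (hp t h)
        have htp' : t ∉ p' := fun h => by simpa using hp' t h
        have htb : t ∈ b := by
          simp only [List.mem_append, List.mem_cons, not_or] at htl htxa
          rcases htl with h | h | h
          · exact absurd h htxa.2
          · subst h; unfold Big at hbig; simp at hbig
          · exact h
        obtain ⟨b1, b2, rfl, hb1⟩ := List.eq_append_cons_of_mem htb
        have e4 : (x ++ a ++ b1) ++ t :: (b2 ++ y) = p' ++ t :: r := by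
          rw [← e3]; simp
        have h5 : x ++ a ++ b1 = p' := by
          refine (first_unique ?_ htp' e4).1
          rw [List.mem_append]
          tauto
        refine hirr s t (star_of_pull (p := a) (q := b1 ++ t :: b2) (p' := a ++ b1) (r := b2)
          hbig hl rfl (fun c hc => hp c (by simp [hc])) (by simp)
          (fun c hc => hp' c (by rw [← h5]; simp at hc ⊢; tauto)))
  · -- `s` lies in `x`
    have h3 : cs.IsReduced ((p ++ a) ++ l ++ y) := by simpa using hpq
    have := Cont.of h3
    rw [← epq]
    simpa using this

lemma starIrreducible_inv {cs : CoxeterSystem M W} {v : W} (h : StarIrreducible cs v) :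
    LeftStarIrreducible cs v ∧ LeftStarIrreducible cs v⁻¹ := by
  refine ⟨fun s t => (h s t).1, fun s t h' => (h s t).2 ?_⟩
  obtain ⟨h1, h2, h3⟩ := h'
  refine ⟨h1, cs.isLeftDescent_inv_iff.1 h2, ?_⟩
  rw [← cs.isLeftDescent_inv_iff]
  simpa using h3

lemma cont_of_left {cs : CoxeterSystem M W} {w : W} {s : B} (hs : cs.IsLeftDescent w s) :
    Cont cs w (cs.simple s * w) := by
  obtain ⟨m, hm, em⟩ := cs.exists_isReduced (cs.simple s * w)
  have h1 := reduced_cons_of_descent hs hm em.symm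
  have h2 : cs.IsReduced ([s] ++ m ++ []) := by simpa using h1.1
  have := Cont.of h2
  rw [← em] at this
  simpa [h1.2] using this

lemma cont_of_step {cs : CoxeterSystem M W} {w w' : W} (h : StarStep cs w w') :
    Cont cs w w' := by
  obtain ⟨s, t, ⟨h, rfl⟩ | ⟨h, rfl⟩⟩ := h
  · exact cont_of_left h.2.1
  · have := (cont_of_left (cs.isLeftDescent_inv_iff.2 h.2.1)).inv
    simpa using this

lemma cont_of_steps {cs : CoxeterSystem M W} {w w' : W}
    (h : Relation.ReflTransGen (StarStep cs) w w') : Cont cs w w' := by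
  induction h with
  | refl => exact Cont.refl cs w
  | tail _ h2 ih => exact ih.trans (cont_of_step h2)

lemma keep_step {cs : CoxeterSystem M W} {w w' v : W} (hw : PFC cs w) (hc : Cont cs w v)
    (hfull : ∀ l, cs.IsReduced l → cs.wordProd l = v → ∀ a, a ∈ l)
    (hirr : StarIrreducible cs v) (h : StarStep cs w w') : Cont cs w' v := by
  have hi := starIrreducible_inv hirr
  obtain ⟨s, t, ⟨h, rfl⟩ | ⟨h, rfl⟩⟩ := h
  · exact keep_left hw hc hfull hi.1 h
  · have := (keep_left (s := s) (t := t) hw.inv hc.inv (fun l hl e a => ?_) hi.2 ?_).inv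
    · simpa using this
    · have := hfull l.reverse hl.reverse (by simp [e]) a
      simpa using this
    · refine ⟨h.1, cs.isLeftDescent_inv_iff.2 h.2.1, ?_⟩
      rw [← cs.isRightDescent_inv_iff]
      simpa using h.2.2

lemma keep_steps {cs : CoxeterSystem M W} {w w' v : W} (hw : PFC cs w) (hc : Cont cs w v)
    (hfull : ∀ l, cs.IsReduced l → cs.wordProd l = v → ∀ a, a ∈ l)
    (hirr : StarIrreducible cs v) (h : Relation.ReflTransGen (StarStep cs) w w') :
    Cont cs w' v := by
  induction h with
  | refl => exact hc
  | tail h1 h2 ih => exact keep_step (hw.cont (cont_of_steps h1)) ih hfull hirr h2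

/-- Uniqueness, given that the two irreducible elements have full support. -/
lemma unique_of_full {cs : CoxeterSystem M W} {w v v' : W} (hw : PFC cs w)
    (h1 : Relation.ReflTransGen (StarStep cs) w v)
    (h2 : Relation.ReflTransGen (StarStep cs) w v')
    (hv : StarIrreducible cs v) (hv' : StarIrreducible cs v')
    (hf : ∀ l, cs.IsReduced l → cs.wordProd l = v → ∀ a, a ∈ l)
    (hf' : ∀ l, cs.IsReduced l → cs.wordProd l = v' → ∀ a, a ∈ l) : v = v' := by
  have a1 := (keep_steps hw (cont_of_steps h1) hf hv h2).length
  have a2 := (keep_steps hw (cont_of_steps h2) hf' hv' h1).length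
  exact a1.2 (le_antisymm a1.1 a2.1)

end Words

/-! ### Counting argument -/

section Counting

set_option linter.unusedSectionVars false

variable {V : Type*} [DecidableEq V] [Fintype V] (A : V → V → Prop) [DecidableRel A]

/-- Number of neighbours of `i` before its first occurrence. -/
def TT (l : List V) (i : V) : ℕ :=
  if i ∈ l then (l.takeWhile (fun c => c ≠ i)).countP (fun j => A i j) else 0

/-- The neighbour `j` occurs before the first occurrence of `i`. -/
def PP (l : List V) (i j : V) : Prop :=
  A i j ∧ i ∈ l ∧ j ∈ l.takeWhile (fun c => c ≠ i)

instance (l : List V) (i j : V) : Decidable (PP A l i j) := by unfold PP; infer_instance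

/-- Number of distinct neighbours before the first occurrence. -/
def ind (l : List V) (i : V) : ℤ := ∑ j, if PP A l i j then 1 else 0

/-- Number of distinct neighbours first occurring after `i`. -/
def out (l : List V) (i : V) : ℤ := ∑ j, if PP A l j i then 1 else 0

/-- Degree in the support. -/
def dg (l : List V) (i : V) : ℤ := ∑ j, if A i j ∧ i ∈ l ∧ j ∈ l then 1 else 0

/-- Truncated degree. -/
def xx (l : List V) (i : V) : ℤ := min (dg A l i) 2

lemma mem_tw_iff {i j : V} (hij : i ≠ j) : ∀ {l : List V}, i ∈ l → j ∈ l →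
    (j ∈ l.takeWhile (fun c => c ≠ i) ↔ ¬ i ∈ l.takeWhile (fun c => c ≠ j))
  | [], h, _ => by simp at h
  | a :: l, hi, hj => by
    by_cases h1 : a = i
    · subst h1
      simp [hij]
    · by_cases h2 : a = j
      · subst h2
        simp [h1]
      · have hi' : i ∈ l := by simpa [Ne.symm h1] using hi
        have hj' : j ∈ l := by simpa [Ne.symm h2] using hj
        have := mem_tw_iff hij hi' hj'
        simp [h1, h2, Ne.symm h1, Ne.symm h2] at this ⊢
        exact this

variable {A}

lemma mem_of_tw {l : List V} {i j : V} (h : j ∈ l.takeWhile (fun c => c ≠ i)) : j ∈ l :=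
  (List.takeWhile_sublist _).subset h

lemma dg_eq (hs : ∀ i j, A i j → A j i) (hi : ∀ i, ¬ A i i) (l : List V) (i : V) :
    dg A l i = ind A l i + out A l i := by
  unfold dg ind out
  rw [← Finset.sum_add_distrib]
  refine Finset.sum_congr rfl fun j _ => ?_
  by_cases h : A i j
  · have h' := hs _ _ h
    have hne : i ≠ j := by rintro rfl; exact hi _ h
    by_cases h1 : i ∈ l
    · by_cases h2 : j ∈ l
      · have := mem_tw_iff hne h1 h2
        by_cases h3 : j ∈ l.takeWhile (fun c => c ≠ i)
        · have h4 := this.1 h3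
          rw [if_pos ⟨h, h1, h2⟩, if_pos ⟨h, h1, h3⟩, if_neg (fun hh => h4 hh.2.2)]; rfl
        · have h4 : i ∈ l.takeWhile (fun c => c ≠ j) := by
            by_contra h5; exact h3 (this.2 h5)
          rw [if_pos ⟨h, h1, h2⟩, if_neg (fun hh => h3 hh.2.2), if_pos ⟨h', h2, h4⟩]; rfl
      · rw [if_neg (fun hh => h2 hh.2.2), if_neg (fun hh => h2 (mem_of_tw hh.2.2)),
          if_neg (fun hh => h2 hh.2.1)]; rfl
    · rw [if_neg (fun hh => h1 hh.2.1), if_neg (fun hh => h1 hh.2.1),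
        if_neg (fun hh => h1 (mem_of_tw hh.2.2))]; rfl
  · rw [if_neg (fun hh => h hh.1), if_neg (fun hh => h hh.1),
      if_neg (fun hh => h (hs _ _ hh.1))]; rfl

lemma sum_ind_eq (l : List V) : ∑ i, ind A l i = ∑ i, out A l i := by
  unfold ind out
  exact Finset.sum_comm

lemma ind_le (l : List V) (i : V) : ind A l i ≤ TT A l i := by
  unfold ind TT
  rw [Finset.sum_boole]
  by_cases h : i ∈ l
  · rw [if_pos h, List.countP_eq_length_filter]
    norm_cast
    refine le_trans (Finset.card_le_card ?_) (List.toFinset_card_le _)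
    intro j hj
    have hj := (Finset.mem_filter.1 hj).2
    simp only [List.mem_toFinset, List.mem_filter, decide_eq_true_eq]
    exact ⟨hj.2.2, hj.1⟩
  · rw [if_neg h]
    norm_cast
    rw [Nat.le_zero, Finset.card_eq_zero, Finset.filter_eq_empty_iff]
    intro j _ hj
    exact h hj.2.1

lemma T_pos_ind {l : List V} {i : V} (h : TT A l i ≠ 0) : 1 ≤ ind A l i := by
  unfold TT at h
  by_cases hl : i ∈ l
  · rw [if_pos hl] at h
    obtain ⟨j, hj, hA⟩ := List.countP_pos_iff.1 (Nat.pos_of_ne_zero h)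
    unfold ind
    have hP : PP A l i j := ⟨by simpa using hA, hl, hj⟩
    calc (1 : ℤ) = if PP A l i j then 1 else 0 := by rw [if_pos hP]
      _ ≤ _ := Finset.single_le_sum (f := fun j => if PP A l i j then (1 : ℤ) else 0)
        (fun k _ => by split_ifs <;> simp) (Finset.mem_univ j)
  · simp [hl] at h

/-- Number of children with a single parent occurrence. -/
def bb (A : V → V → Prop) [DecidableRel A] (l : List V) (i : V) : ℤ :=
  ∑ c, if PP A l c i ∧ TT A l c = 1 then 1 else 0

lemma local_ineq (T : ℕ) (d i o b : ℤ) (hd : d = i + o) (hi : i ≤ T) (hi0 : 0 ≤ i)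
    (hb : b ≤ o) (hb0 : 0 ≤ b) (hT : T = 0 → b = 0) (hT' : T ≠ 0 → 1 ≤ i) :
    0 ≤ min d 2 * T + (d - min d 2) - 2 * i + (if T = 1 then 1 else 0) - b := by
  rcases Nat.lt_or_ge T 2 with h | h
  · interval_cases T
    · have := hT rfl
      simp; omega
    · have := hT' (by simp)
      simp; omega
  · have := hT' (by omega)
    have h1 : T ≠ 1 := by omega
    rw [if_neg h1]
    have h2 : (2 : ℤ) ≤ T := by exact_mod_cast h
    rcases le_or_gt d 1 with h3 | h3
    · have : d = 1 := by omega
      subst this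
      simp; omega
    · rw [min_eq_right (by omega)]
      omega

lemma top_ineq (hs : ∀ i j, A i j → A j i) (hi : ∀ i, ¬ A i i) (l : List V)
    (hI : ∀ i j, PP A l i j → TT A l i = 1 → TT A l j ≠ 0) :
    ∑ i, xx A l i ≤ ∑ i, xx A l i * TT A l i := by
  have h1 : ∀ i, 0 ≤ xx A l i * TT A l i + (dg A l i - xx A l i) - 2 * ind A l i
      + (if TT A l i = 1 then 1 else 0) - bb A l i := by
    intro i
    refine local_ineq (TT A l i) (dg A l i) (ind A l i) (out A l i) (bb A l i)
      (dg_eq hs hi l i) (ind_le l i) ?_ ?_ ?_ ?_ (fun h => T_pos_ind h)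
    · exact Finset.sum_nonneg fun j _ => by split_ifs <;> simp
    · refine Finset.sum_le_sum fun j _ => ?_
      by_cases h : PP A l j i
      · rw [if_pos h]; split_ifs <;> simp
      · rw [if_neg h, if_neg (fun hh => h hh.1)]
    · exact Finset.sum_nonneg fun j _ => by split_ifs <;> simp
    · intro h
      refine Finset.sum_eq_zero fun j _ => ?_
      rw [if_neg]
      rintro ⟨h2, h3⟩
      exact hI j i h2 h3 h
  have h2 := Finset.sum_nonneg fun i (_ : i ∈ Finset.univ) => h1 i
  have h3 : ∑ i, (if TT A l i = 1 then (1 : ℤ) else 0) ≤ ∑ i, bb A l i := by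
    unfold bb
    rw [Finset.sum_comm]
    refine Finset.sum_le_sum fun c _ => ?_
    by_cases h : TT A l c = 1
    · have := T_pos_ind (A := A) (l := l) (i := c) (by omega)
      simpa [h, ind] using this
    · simp [h]
  have h4 := sum_ind_eq (A := A) l
  have h5 : ∑ i, dg A l i = ∑ i, ind A l i + ∑ i, out A l i := by
    rw [← Finset.sum_add_distrib]
    exact Finset.sum_congr rfl fun i _ => dg_eq hs hi l i
  simp only [Finset.sum_add_distrib, Finset.sum_sub_distrib, ← Finset.mul_sum] at h2
  linarith

lemma TT_split {p q : List V} {i : V} (h : i ∉ p) :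
    TT A (p ++ i :: q) i = p.countP (fun j => A i j) := by
  unfold TT
  rw [if_pos (by simp), List.takeWhile_append_of_pos]
  · simp
  · intro a ha
    have : a ≠ i := by rintro rfl; exact h ha
    simpa using this

lemma count_suffix (hi : ∀ i, ¬ A i i) (l : List V) (i : V)
    (hsep : ∀ p m q, l = p ++ i :: (m ++ i :: q) → i ∉ m → 2 ≤ m.countP (fun j => A i j)) :
    ∀ (k : ℕ) (r p : List V), r.length ≤ k → l = p ++ i :: r →
      2 * r.count i + TT A l.reverse i ≤ r.countP (fun j => A i j) := by
  intro k
  induction k with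
  | zero =>
    intro r p hr e
    have : r = [] := List.eq_nil_of_length_eq_zero (by omega)
    subst this e
    have := TT_split (A := A) (p := []) (q := p.reverse) (i := i) (by simp)
    simp at this ⊢
    exact this
  | succ k ih =>
    intro r p hr e
    by_cases h : i ∈ r
    · obtain ⟨m, r', rfl, hm⟩ := List.eq_append_cons_of_mem h
      have h1 := hsep p m r' e hm
      have h2 := ih r' (p ++ i :: m) (by simp at hr; omega) (by simp [e])
      have h3 : m.count i = 0 := List.count_eq_zero_of_not_mem hm
      simp [List.count_append, List.countP_append, h3, hi]
      omega
    · subst e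
      have e2 : (p ++ i :: r).reverse = r.reverse ++ i :: p.reverse := by simp
      rw [e2, TT_split (by simpa using h)]
      have h3 : r.count i = 0 := List.count_eq_zero_of_not_mem h
      simp [h3]

lemma count_ineq (hi : ∀ i, ¬ A i i) (l : List V) (i : V)
    (hsep : ∀ p m q, l = p ++ i :: (m ++ i :: q) → i ∉ m → 2 ≤ m.countP (fun j => A i j))
    (hl : i ∈ l) :
    2 * l.count i + TT A l i + TT A l.reverse i ≤ l.countP (fun j => A i j) + 2 := by
  obtain ⟨p, r, e, hp⟩ := List.eq_append_cons_of_mem hl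
  have h1 := count_suffix hi l i hsep r.length r p le_rfl e
  have h2 : TT A l i = p.countP (fun j => A i j) := by rw [e, TT_split hp]
  have h3 : l.count i = r.count i + 1 := by
    rw [e]; simp [List.count_append, List.count_eq_zero_of_not_mem hp]
  have h4 : l.countP (fun j => A i j) =
      p.countP (fun j => A i j) + r.countP (fun j => A i j) := by
    rw [e]; simp [List.countP_append, hi]
  omega

lemma countP_eq_sum (l : List V) (i : V) :
    (l.countP (fun j => A i j) : ℤ) = ∑ j, (if A i j then 1 else 0) * (l.count j : ℤ) := by
  induction l with
  | nil => simp
  | cons a l ih =>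
    simp only [List.countP_cons, List.count_cons]
    push_cast
    rw [ih]
    simp only [mul_add, Finset.sum_add_distrib]
    congr 1
    simp

lemma xx_reverse (l : List V) (i : V) : xx A l.reverse i = xx A l i := by
  simp [xx, dg]

/-- The main counting statement: support is either totally disconnected or everything. -/
theorem full_or_empty (hs : ∀ i j, A i j → A j i) (hi : ∀ i, ¬ A i i) (l : List V)
    (hI : ∀ i j, PP A l i j → TT A l i = 1 → TT A l j ≠ 0)
    (hI' : ∀ i j, PP A l.reverse i j → TT A l.reverse i = 1 → TT A l.reverse j ≠ 0)
    (hsep : ∀ i p m q, l = p ++ i :: (m ++ i :: q) → i ∉ m → 2 ≤ m.countP (fun j => A i j))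
    (δ : V → ℤ) (hδ : ∀ i, ∑ j, (if A i j then 1 else 0) * δ j = 2 * δ i)
    (hδ2 : ∀ i, δ i = 2 ∨ (δ i = 1 ∧ ∀ j k, A i j → A i k → j = k))
    (hconn : ∀ N : V → Prop, (∃ i, N i) → (∀ i j, N i → A i j → N j) → ∀ i, N i) :
    (∀ a ∈ l, ∀ b ∈ l, ¬ A a b) ∨ ∀ a, a ∈ l := by
  have hdg0 : ∀ i, 0 ≤ dg A l i := fun i =>
    Finset.sum_nonneg fun j _ => by split_ifs <;> simp
  have hx0 : ∀ i, 0 ≤ xx A l i := fun i => by have := hdg0 i; unfold xx; omega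
  have hx2 : ∀ i, xx A l i ≤ 2 := fun i => by unfold xx; omega
  have hxF : ∀ i, i ∉ l → xx A l i = 0 := fun i h => by
    have : dg A l i = 0 := Finset.sum_eq_zero fun j _ => by simp [h]
    unfold xx; omega
  have hxδ : ∀ i, xx A l i ≤ δ i := by
    intro i
    rcases hδ2 i with h | ⟨h, h'⟩
    · rw [h]; exact hx2 i
    · have : dg A l i ≤ 1 := by
        unfold dg
        rw [Finset.sum_boole]
        norm_cast
        rw [Finset.card_le_one]
        intro a ha b hb
        exact h' a b (Finset.mem_filter.1 ha).2.1 (Finset.mem_filter.1 hb).2.1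
      unfold xx; omega
  let e : V → V → ℤ := fun i j => if A i j then 1 else 0
  have he0 : ∀ i j, 0 ≤ e i j := fun i j => by simp only [e]; split_ifs <;> simp
  have hesymm : ∀ i j, e i j = e j i := fun i j => by
    simp only [e]
    by_cases h : A i j
    · simp [h, hs _ _ h]
    · have h' : ¬ A j i := fun hh => h (hs _ _ hh)
      simp [h, h']
  have hswap : ∀ f g : V → ℤ, ∑ i, f i * ∑ j, e i j * g j = ∑ i, g i * ∑ j, e i j * f j := by
    intro f g
    simp only [Finset.mul_sum]
    rw [Finset.sum_comm]
    refine Finset.sum_congr rfl fun i _ => Finset.sum_congr rfl fun j _ => ?_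
    rw [hesymm j i]; ring
  let y : V → ℤ := fun i => 2 * xx A l i - ∑ j, e i j * xx A l j
  have hy0 : ∀ i, i ∈ l → 0 ≤ y i := by
    intro i hil
    rcases le_or_gt (dg A l i) 1 with h | h
    · have h1 : xx A l i = dg A l i := by unfold xx; omega
      have h2 : ∑ j, e i j * xx A l j ≤ 2 * dg A l i := by
        unfold dg
        rw [Finset.mul_sum]
        refine Finset.sum_le_sum fun j _ => ?_
        by_cases h3 : A i j
        · by_cases h4 : j ∈ l
          · have := hx2 j
            simpa [e, h3, h4, hil] using this
          · simp [e, h4, hxF j h4]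
        · simp [e, h3]
      simp only [y]; omega
    · have h1 : xx A l i = 2 := by unfold xx; omega
      have h2 : ∑ j, e i j * xx A l j ≤ ∑ j, e i j * δ j :=
        Finset.sum_le_sum fun j _ => mul_le_mul_of_nonneg_left (hxδ j) (he0 i j)
      have h3 : ∑ j, e i j * δ j = 2 * δ i := hδ i
      have h4 : δ i ≤ 2 := by rcases hδ2 i with h | h <;> omega
      simp only [y]; omega
  have hcy : ∑ i, (l.count i : ℤ) * y i ≤ 0 := by
    have t1 := top_ineq hs hi l hI
    have t2 := top_ineq hs hi l.reverse hI'
    simp only [xx_reverse] at t2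
    have t3 : ∑ i, (xx A l i * (2 * (l.count i : ℤ)) + xx A l i * TT A l i
        + xx A l i * TT A l.reverse i) ≤
        ∑ i, (xx A l i * (∑ j, e i j * (l.count j : ℤ)) + 2 * xx A l i) := by
      refine Finset.sum_le_sum fun i _ => ?_
      by_cases hil : i ∈ l
      · have h1 := count_ineq hi l i (hsep i) hil
        have h2 : (2 * (l.count i : ℤ) + TT A l i + TT A l.reverse i) ≤
          (l.countP (fun j => A i j) : ℤ) + 2 := by exact_mod_cast h1
        rw [countP_eq_sum] at h2
        have h3 := mul_le_mul_of_nonneg_left h2 (hx0 i)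
        simp only [e]
        linarith
      · simp [hxF i hil]
    simp only [Finset.sum_add_distrib, ← Finset.mul_sum] at t3
    have t4 := hswap (xx A l) (fun i => (l.count i : ℤ))
    simp only [y, mul_sub, Finset.sum_sub_distrib]
    have t5 : ∑ i, (l.count i : ℤ) * (2 * xx A l i) = ∑ i, xx A l i * (2 * (l.count i : ℤ)) :=
      Finset.sum_congr rfl fun i _ => by ring
    linarith
  have hcy0 : ∀ i, 0 ≤ (l.count i : ℤ) * y i := by
    intro i
    by_cases hil : i ∈ l
    · exact mul_nonneg (by positivity) (hy0 i hil)
    · simp [List.count_eq_zero_of_not_mem hil]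
  have hyF : ∀ i, i ∈ l → y i = 0 := by
    intro i hil
    have h1 := (Finset.sum_eq_zero_iff_of_nonneg (fun i _ => hcy0 i)).1
      (le_antisymm hcy (Finset.sum_nonneg fun i _ => hcy0 i)) i (Finset.mem_univ i)
    rcases mul_eq_zero.1 h1 with h | h
    · have := List.count_pos_iff.2 hil
      omega
    · exact h
  have hδy : ∑ i, δ i * y i = 0 := by
    have t4 := hswap δ (xx A l)
    have t5 : ∑ i, xx A l i * ∑ j, e i j * δ j = ∑ i, δ i * (2 * xx A l i) :=
      Finset.sum_congr rfl fun i _ => by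
        have : ∑ j, e i j * δ j = 2 * δ i := hδ i
        rw [this]; ring
    simp only [y, mul_sub, Finset.sum_sub_distrib]
    linarith
  have hδ1 : ∀ i, 1 ≤ δ i := fun i => by rcases hδ2 i with h | h <;> omega
  have hy1 : ∀ i, y i ≤ 0 := by
    intro i
    by_cases hil : i ∈ l
    · rw [hyF i hil]
    · have : 0 ≤ ∑ j, e i j * xx A l j :=
        Finset.sum_nonneg fun j _ => mul_nonneg (he0 i j) (hx0 j)
      simp only [y, hxF i hil]; omega
  have hyall : ∀ i, y i = 0 := by
    intro i
    have h0 : ∀ i ∈ Finset.univ, δ i * y i ≤ 0 := fun i _ =>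
      mul_nonpos_of_nonneg_of_nonpos (by have := hδ1 i; omega) (hy1 i)
    have h1 := (Finset.sum_eq_zero_iff_of_nonpos h0).1 hδy i (Finset.mem_univ i)
    rcases mul_eq_zero.1 h1 with h | h
    · have := hδ1 i; omega
    · exact h
  have hout : ∀ i j, i ∉ l → A i j → xx A l j = 0 := by
    intro i j hil hij
    have h1 := hyall i
    simp only [y, hxF i hil] at h1
    have h2 : ∑ j, e i j * xx A l j = 0 := by omega
    have h3 := (Finset.sum_eq_zero_iff_of_nonneg
      (fun j _ => mul_nonneg (he0 i j) (hx0 j))).1 h2 j (Finset.mem_univ j)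
    simpa [e, hij] using h3
  have hpos : ∀ i j, i ∈ l → j ∈ l → A i j → 1 ≤ xx A l i := by
    intro i j hil hjl hij
    have : 1 ≤ dg A l i := by
      unfold dg
      calc (1 : ℤ) = if A i j ∧ i ∈ l ∧ j ∈ l then 1 else 0 := by rw [if_pos ⟨hij, hil, hjl⟩]
        _ ≤ _ := Finset.single_le_sum
          (f := fun j => if A i j ∧ i ∈ l ∧ j ∈ l then (1 : ℤ) else 0)
          (fun k _ => by split_ifs <;> simp) (Finset.mem_univ j)
    unfold xx; omega
  by_cases hcc : ∀ a ∈ l, ∀ b ∈ l, ¬ A a b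
  · exact Or.inl hcc
  · right
    push Not at hcc
    obtain ⟨a, ha, b, hb, hab⟩ := hcc
    have hmem : ∀ i, 1 ≤ xx A l i → i ∈ l := fun i h => by
      by_contra hh; rw [hxF i hh] at h; omega
    have := hconn (fun i => 1 ≤ xx A l i) ⟨a, hpos a b ha hb hab⟩ (by
      intro i j h hij
      have hil := hmem i h
      have hjl : j ∈ l := by
        by_contra hh
        have := hout j i hh (hs _ _ hij)
        omega
      exact hpos j i hjl hil (hs _ _ hij))
    exact fun i => hmem i (this i)

end Counting

/-! ### Irreducible fully commutative elements have trivial or full support -/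

section Support

set_option linter.unusedSectionVars false

variable [DecidableEq B] [Fintype B]

instance decM3 (M : CoxeterMatrix B) : DecidableRel (fun a b : B => M a b = 3) :=
  fun a b => inferInstanceAs (Decidable (M a b = 3))

lemma braid_rel (cs : CoxeterSystem M W) {i j : B} (h : M i j = 3) :
    cs.simple i * (cs.simple j * cs.simple i) = cs.simple j * (cs.simple i * cs.simple j) := by
  have := cs.simple_mul_simple_pow i j
  rw [h, pow_three] at this
  have h1 : (cs.simple i * cs.simple j * cs.simple i) * (cs.simple j * cs.simple i * cs.simple j)
      = 1 := by simpa only [mul_assoc] using this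
  have h2 := mul_eq_one_iff_eq_inv.1 h1
  simpa [mul_assoc] using h2

lemma comm_of_countP_zero (hM : ∀ a b, a ≠ b → M a b = 2 ∨ M a b = 3) {i : B} {p : List B}
    (hi : i ∉ p) (h : p.countP (fun j => M i j = 3) = 0) : ∀ c ∈ p, M i c = 2 := by
  intro c hc
  have h1 := List.countP_eq_zero.1 h c hc
  have h2 : i ≠ c := by rintro rfl; exact hi hc
  rcases hM i c h2 with h3 | h3
  · exact h3
  · simp [h3] at h1

lemma irr_cond (hM : ∀ a b, a ≠ b → M a b = 2 ∨ M a b = 3) {cs : CoxeterSystem M W}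
    {l : List B} (hl : cs.IsReduced l) (hirr : LeftStarIrreducible cs (cs.wordProd l)) :
    ∀ i j, PP (fun a b => M a b = 3) l i j → TT (fun a b => M a b = 3) l i = 1 →
      TT (fun a b => M a b = 3) l j ≠ 0 := by
  intro i j hP hT hT0
  obtain ⟨hij, hil, hj⟩ := hP
  obtain ⟨p, q, rfl, hp⟩ := List.eq_append_cons_of_mem hil
  rw [TT_split hp] at hT
  have htw : (p ++ i :: q).takeWhile (fun c => c ≠ i) = p := by
    rw [List.takeWhile_append_of_pos]
    · simp
    · intro a ha
      have : a ≠ i := by rintro rfl; exact hp ha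
      simpa using this
  rw [htw] at hj
  obtain ⟨p1, p2, rfl, hp1⟩ := List.eq_append_cons_of_mem hj
  simp only [List.append_assoc, List.cons_append] at hT0
  rw [TT_split hp1] at hT0
  simp only [List.countP_append, List.countP_cons, hij, decide_true, if_true] at hT
  have hip : i ∉ p1 ∧ i ∉ p2 := by
    simp at hp; tauto
  have c1 := comm_of_countP_zero hM hp1 hT0
  have c2 := comm_of_countP_zero hM hip.1 (by omega)
  have c3 := comm_of_countP_zero hM hip.2 (by omega)
  refine hirr j i (star_of_pull (p := p1) (q := p2 ++ i :: q) (p' := p1 ++ p2) (r := q)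
    ?_ hl (by simp) c1 (by simp) ?_)
  · left; rw [M.symmetric, hij]
  · intro c hc
    rcases List.mem_append.1 hc with h | h
    · exact c2 c h
    · exact c3 c h

lemma sep_cond (hM : ∀ a b, a ≠ b → M a b = 2 ∨ M a b = 3) {cs : CoxeterSystem M W}
    {l : List B} (hl : cs.IsReduced l) (hfc : PFC cs (cs.wordProd l)) :
    ∀ i p m q, l = p ++ i :: (m ++ i :: q) → i ∉ m → 2 ≤ m.countP (fun j => M i j = 3) := by
  rintro i p m q rfl him
  by_contra hlt
  have hcase : m.countP (fun j => M i j = 3) = 0 ∨ m.countP (fun j => M i j = 3) = 1 := by omega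
  rcases hcase with h | h
  · have c1 := comm_of_countP_zero hM him h
    have h1 : cs.IsReduced (i :: (m ++ i :: q)) := right_of_append hl
    have e : cs.wordProd (i :: (m ++ i :: q)) = cs.wordProd (m ++ q) := by
      rw [wordProd_cons, pull cs q c1, wordProd_cons, simple_mul_simple_cancel_left]
    have h2 := cs.length_wordProd_le (m ++ q)
    rw [← e, h1.eq] at h2
    simp at h2
  · obtain ⟨j, hj, hij⟩ := List.countP_pos_iff.1 (show 0 < m.countP (fun j => M i j = 3) by omega)
    have hij : M i j = 3 := by simpa using hij
    obtain ⟨m1, m2, rfl, -⟩ := List.eq_append_cons_of_mem hj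
    simp only [List.countP_append, List.countP_cons, hij, decide_true, if_true] at h
    have him' : i ∉ m1 ∧ i ∉ m2 ∧ i ≠ j := by
      simp at him; tauto
    have c1 := comm_of_countP_zero hM him'.1 (by omega)
    have c2 := comm_of_countP_zero hM him'.2.1 (by omega)
    have e1 : cs.wordProd (p ++ i :: (m1 ++ j :: m2 ++ i :: q)) =
        cs.wordProd (p ++ (m1 ++ i :: j :: i :: (m2 ++ q))) := by
      rw [wordProd_append, wordProd_append, pull cs _ c1]
      congr 1
      simp only [List.append_assoc, List.cons_append, wordProd_cons, wordProd_append cs m1]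
      have := pull cs q c2
      rw [this, wordProd_cons]
    have e2 : cs.wordProd (p ++ (m1 ++ i :: j :: i :: (m2 ++ q))) =
        cs.wordProd (p ++ (m1 ++ j :: i :: j :: (m2 ++ q))) := by
      have := braid_rel cs hij
      rw [wordProd_append, wordProd_append, wordProd_append, wordProd_append]
      congr 2
      simp only [wordProd_cons]
      calc _ = cs.simple i * (cs.simple j * cs.simple i) * cs.wordProd (m2 ++ q) := by
            simp only [mul_assoc]
        _ = _ := by rw [this]; simp only [mul_assoc]
    have r1 := reduced_congr hl e1 (by simp; omega)
    have r2 := reduced_congr r1 e2 (by simp)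
    have := hfc _ _ r1 r2 e1.symm (e1.trans e2).symm i i (by simp)
    have h3 := congrArg List.length this
    simp [List.filter_append, List.filter_cons, Ne.symm him'.2.2] at h3

theorem cc_or_full (hM : ∀ a b, a ≠ b → M a b = 2 ∨ M a b = 3)
    (δ : B → ℤ) (hδ : ∀ i, ∑ j, (if M i j = 3 then 1 else 0) * δ j = 2 * δ i)
    (hδ2 : ∀ i, δ i = 2 ∨ (δ i = 1 ∧ ∀ j k, M i j = 3 → M i k = 3 → j = k))
    (hconn : ∀ N : B → Prop, (∃ i, N i) → (∀ i j, N i → M i j = 3 → N j) → ∀ i, N i)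
    {cs : CoxeterSystem M W} {v : W} (hfc : PFC cs v) (hirr : StarIrreducible cs v)
    (hcc : ¬ IsCC cs v) : ∀ l, cs.IsReduced l → cs.wordProd l = v → ∀ a, a ∈ l := by
  rintro l hl rfl
  have hi := starIrreducible_inv hirr
  rw [← wordProd_reverse] at hi
  rcases full_or_empty (A := fun a b => M a b = 3) (fun i j h => by rw [M.symmetric]; exact h)
    (fun i => by simp) l (irr_cond hM hl hi.1) (irr_cond hM hl.reverse hi.2)
    (sep_cond hM hl hfc) δ hδ hδ2 hconn with h | h
  · refine absurd ⟨l, hl, rfl, fun a ha b hb hab => ?_⟩ hcc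
    exact (hM a b hab).resolve_right (h a ha b hb)
  · exact h

end Support

/-! ### Type D̃ -/

section TypeD

lemma DMatrix_three (n : ℕ) (i j : Fin (n + 3)) : DMatrix n i j = 3 ↔ DAdj n i j := by
  simp only [DMatrix, Matrix.of_apply]
  split_ifs <;> simp_all

lemma DMatrix_or (n : ℕ) (i j : Fin (n + 3)) (h : i ≠ j) :
    DMatrix n i j = 2 ∨ DMatrix n i j = 3 := by
  simp only [DMatrix, Matrix.of_apply]
  split_ifs <;> simp

/-- The null vector of the affine Cartan matrix. -/
def dδ (n : ℕ) (k : ℕ) : ℤ := if 2 ≤ k ∧ k ≤ n then 2 else 1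

lemma dδ_sum (n : ℕ) (hn : 2 ≤ n) (i : Fin (n + 3)) :
    ∑ j : Fin (n + 3), (if DMatrix n i j = 3 then 1 else 0) * dδ n j = 2 * dδ n i := by
  have key : ∀ S : Finset ℕ, (∀ k ∈ S, k < n + 3) → (∀ k, k < n + 3 → (DAdj n i k ↔ k ∈ S)) →
      ∑ j : Fin (n + 3), (if DMatrix n i j = 3 then 1 else 0) * dδ n j = ∑ k ∈ S, dδ n k := by
    intro S hS1 hS2
    have e1 := Fin.sum_univ_eq_sum_range
      (fun k => (if DAdj n i k then (1 : ℤ) else 0) * dδ n k) (n + 3)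
    simp only [DMatrix_three]
    rw [e1]
    simp only [ite_mul, one_mul, zero_mul]
    rw [← Finset.sum_filter]
    refine Finset.sum_congr ?_ fun _ _ => rfl
    ext k
    simp only [Finset.mem_filter, Finset.mem_range]
    constructor
    · rintro ⟨h1, h2⟩; exact (hS2 k h1).1 h2
    · intro h; exact ⟨hS1 k h, (hS2 k (hS1 k h)).2 h⟩
  obtain ⟨i, hi⟩ := i
  simp only at key ⊢
  by_cases h0 : i ≤ 1
  · rw [key {2} (by simp <;> omega) (by intro k hk; simp [DAdj, DHalf]; omega)]
    rw [Finset.sum_singleton]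
    unfold dδ
    rw [if_pos (by omega), if_neg (by omega)]; norm_num
  by_cases h1 : n < i
  · rw [key {n} (by simp) (by intro k hk; simp [DAdj, DHalf]; omega)]
    rw [Finset.sum_singleton]
    unfold dδ
    rw [if_pos (by omega), if_neg (by omega)]; norm_num
  by_cases h2 : i = 2
  · by_cases h3 : n = 2
    · rw [key {0, 1, n + 1, n + 2} (by simp <;> omega) (by intro k hk; simp [DAdj, DHalf]; omega)]
      subst h3 h2
      simp [dδ]
    · rw [key {0, 1, 3} (by simp <;> omega) (by intro k hk; simp [DAdj, DHalf]; omega)]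
      have : 3 ≤ n := by omega
      subst h2
      simp [dδ, this, hn]
  by_cases h3 : i = n
  · rw [key {n - 1, n + 1, n + 2} (by simp <;> omega) (by intro k hk; simp [DAdj, DHalf]; omega)]
    rw [Finset.sum_insert (by simp <;> omega), Finset.sum_insert (by simp), Finset.sum_singleton]
    unfold dδ
    rw [if_pos (by omega), if_neg (by omega), if_neg (by omega), if_pos (by omega)]; norm_num
  · rw [key {i - 1, i + 1} (by simp <;> omega) (by intro k hk; simp [DAdj, DHalf]; omega)]
    rw [Finset.sum_insert (by simp <;> omega), Finset.sum_singleton]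
    unfold dδ
    rw [if_pos (by omega), if_pos (by omega), if_pos (by omega)]; norm_num

lemma dδ_two (n : ℕ) (hn : 2 ≤ n) (i : Fin (n + 3)) : dδ n i = 2 ∨ (dδ n i = 1 ∧
    ∀ j k, DMatrix n i j = 3 → DMatrix n i k = 3 → j = k) := by
  unfold dδ
  split_ifs with h
  · exact Or.inl rfl
  · refine Or.inr ⟨rfl, fun j k h1 h2 => ?_⟩
    rw [DMatrix_three] at h1 h2
    unfold DAdj DHalf at h1 h2
    ext
    omega

lemma D_conn (n : ℕ) (hn : 2 ≤ n) (N : Fin (n + 3) → Prop) (hne : ∃ i, N i)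
    (hcl : ∀ i j, N i → DMatrix n i j = 3 → N j) : ∀ i, N i := by
  have hcl' : ∀ a b (ha : a < n + 3) (hb : b < n + 3), N ⟨a, ha⟩ → DAdj n a b → N ⟨b, hb⟩ :=
    fun a b ha hb h1 h2 => hcl _ _ h1 ((DMatrix_three n _ _).2 h2)
  have down : ∀ k (hk : k ≤ n), 2 ≤ k → N ⟨k, by omega⟩ → N ⟨2, by omega⟩ := by
    intro k hk h2
    induction k, h2 using Nat.le_induction with
    | base => exact id
    | succ k hk2 ih =>
      intro h
      exact ih (by omega) (hcl' _ _ _ _ h (by unfold DAdj DHalf; omega))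
  have h2 : N ⟨2, by omega⟩ := by
    obtain ⟨⟨i, hi⟩, h⟩ := hne
    by_cases h0 : i ≤ 1
    · exact hcl' _ _ _ _ h (by unfold DAdj DHalf; omega)
    by_cases h1 : n < i
    · exact down n le_rfl hn (hcl' _ _ _ (by omega) h (by unfold DAdj DHalf; omega))
    · exact down i (by omega) (by omega) h
  have up : ∀ k, 2 ≤ k → ∀ (hk : k ≤ n), N ⟨k, by omega⟩ := by
    intro k hk2
    induction k, hk2 using Nat.le_induction with
    | base => exact fun _ => h2
    | succ k hk2 ih =>
      intro hk
      exact hcl' _ _ _ _ (ih (by omega)) (by unfold DAdj DHalf; omega)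
  rintro ⟨i, hi⟩
  by_cases h0 : i ≤ 1
  · exact hcl' _ _ _ _ h2 (by unfold DAdj DHalf; omega)
  by_cases h1 : n < i
  · exact hcl' _ _ _ _ (up n hn le_rfl) (by unfold DAdj DHalf; omega)
  · exact up i (by omega) (by omega)

end TypeD

theorem stmt19 (n : ℕ) (hn : 2 ≤ n) {W : Type*} [Group W]
    (cs : CoxeterSystem (DMatrix n) W) (w v v' : W) (hw : IsFC cs w)
    (h1 : Relation.ReflTransGen (StarStep cs) w v)
    (h2 : Relation.ReflTransGen (StarStep cs) w v')
    (hv : StarIrreducible cs v) (hv' : StarIrreducible cs v')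
    (hcc : ¬ IsCC cs v) (hcc' : ¬ IsCC cs v') :
    v = v' := by
  have hfull : ∀ u, PFC cs u → StarIrreducible cs u → ¬ IsCC cs u →
      ∀ l, cs.IsReduced l → cs.wordProd l = u → ∀ a, a ∈ l := fun u h1 h2 h3 =>
    cc_or_full (DMatrix_or n) (fun i => dδ n i) (dδ_sum n hn) (dδ_two n hn) (D_conn n hn) h1 h2 h3
  have hp := hw.pfc
  exact unique_of_full hp h1 h2 hv hv' (hfull v (hp.cont (cont_of_steps h1)) hv hcc)
    (hfull v' (hp.cont (cont_of_steps h2)) hv' hcc')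


end CoxFC
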